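/- Let C_G(E) denote the capacity of the average-intensity-constrained Gaussian optical intensity channel. Then lim_{E → 0⁺} C_G(E) / (E · √(log(1/E))) = 1/√2. -/

import Mathlib

open MeasureTheory ProbabilityTheory Filter
open scoped Classical

/-- Kullback–Leibler divergence (natural logarithm), with value `⊤` when it is
not defined as a real number. -/
noncomputable def klDiv {α : Type*} [MeasurableSpace α] (μ ν : Measure α) : EReal :=
  if μ ≪ ν ∧ Integrable (fun x => Real.log (μ.rnDeriv ν x).toReal) μ
  then ((∫ x, Real.log (μ.rnDeriv ν x).toReal ∂μ : ℝ) : EReal)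
  else ⊤

/-- Mutual information between the input `X ~ μ` and the output `Y = X + Z` of the
Gaussian optical intensity channel, where `Z ~ N(0,1)` is independent of `X`:
the KL divergence between the joint law of `(X, X + Z)` and the product of its
two marginals. -/
noncomputable def gaussianMI (μ : Measure ℝ) : EReal :=
  let joint : Measure (ℝ × ℝ) :=
    (μ.prod (gaussianReal 0 1)).map (fun p => (p.1, p.1 + p.2))
  klDiv joint (joint.fst.prod joint.snd)

/-- Capacity of the average-intensity-constrained Gaussian optical intensity channel:
the supremum of the mutual information over all probability measures on `ℝ`
concentrated on `[0, ∞)` with mean at most `E`. -/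
noncomputable def C_G (E : ℝ) : EReal :=
  ⨆ (μ : Measure ℝ) (_ : IsProbabilityMeasure μ) (_ : μ (Set.Iio 0) = 0)
    (_ : ∫⁻ x, ENNReal.ofReal x ∂μ ≤ ENNReal.ofReal E), gaussianMI μ


section LowIntensity

open Real

/-- Density, with respect to Lebesgue measure, of the channel output for the input law `μ`. -/
noncomputable def outputDensity (μ : Measure ℝ) (y : ℝ) : ℝ :=
  ∫ x, gaussianPDFReal 0 1 (y - x) ∂μ

/-- Information density of the channel as a function of the input and the noise. -/
noncomputable def infoDensity (μ : Measure ℝ) (p : ℝ × ℝ) : ℝ :=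
  log (gaussianPDFReal 0 1 p.2 / outputDensity μ (p.1 + p.2))

lemma gaussianPDFReal_zero_one (z : ℝ) :
    gaussianPDFReal 0 1 z = (√(2 * π))⁻¹ * exp (-z ^ 2 / 2) := by
  simp [gaussianPDFReal]

lemma gaussianPDFReal_zero_one_le (z : ℝ) : gaussianPDFReal 0 1 z ≤ (√(2 * π))⁻¹ := by
  rw [gaussianPDFReal_zero_one]
  refine mul_le_of_le_one_right (by positivity) (exp_le_one_iff.2 ?_)
  nlinarith [sq_nonneg z]

lemma gaussianPDFReal_zero_one_pos (z : ℝ) : 0 < gaussianPDFReal 0 1 z :=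
  gaussianPDFReal_pos _ _ _ one_ne_zero

/-- Joint law of the input and the output of the channel. -/
noncomputable def channelJoint (μ : Measure ℝ) : Measure (ℝ × ℝ) :=
  (μ.prod (gaussianReal 0 1)).map (fun p => (p.1, p.1 + p.2))

lemma fst_channelJoint (μ : Measure ℝ) : (channelJoint μ).fst = μ := by
  rw [channelJoint, Measure.fst, Measure.map_map measurable_fst (by fun_prop)]
  exact Measure.fst_prod

section Output

variable (μ : Measure ℝ) [IsProbabilityMeasure μ]

lemma integrable_gaussianPDFReal_sub (y : ℝ) :
    Integrable (fun x ↦ gaussianPDFReal 0 1 (y - x)) μ := by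
  refine Integrable.of_bound (C := (√(2 * π))⁻¹)
    ((measurable_gaussianPDFReal 0 1).comp (measurable_const.sub measurable_id)).aestronglyMeasurable
    (ae_of_all _ fun x ↦ ?_)
  rw [norm_of_nonneg (gaussianPDFReal_zero_one_pos _).le]
  exact gaussianPDFReal_zero_one_le _

lemma outputDensity_pos (y : ℝ) : 0 < outputDensity μ y := by
  refine (integral_pos_iff_support_of_nonneg
    (fun x ↦ (gaussianPDFReal_zero_one_pos (y - x)).le) (integrable_gaussianPDFReal_sub μ y)).2 ?_
  have : Function.support (fun x ↦ gaussianPDFReal 0 1 (y - x)) = Set.univ := by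
    ext x
    simpa using (gaussianPDFReal_zero_one_pos (y - x)).ne'
  simp [this]

lemma outputDensity_le (y : ℝ) : outputDensity μ y ≤ (√(2 * π))⁻¹ := by
  have h := integral_mono (integrable_gaussianPDFReal_sub μ y) (integrable_const (√(2 * π))⁻¹)
    fun x ↦ gaussianPDFReal_zero_one_le (y - x)
  simpa [outputDensity] using h

lemma measurable_outputDensity : Measurable (outputDensity μ) := by
  have h : Measurable (fun p : ℝ × ℝ ↦ gaussianPDFReal 0 1 (p.1 - p.2)) :=
    (measurable_gaussianPDFReal 0 1).comp (measurable_fst.sub measurable_snd)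
  exact h.stronglyMeasurable.integral_prod_right.measurable

lemma measurable_infoDensity : Measurable (infoDensity μ) :=
  measurable_log.comp (((measurable_gaussianPDFReal 0 1).comp measurable_snd).div
    ((measurable_outputDensity μ).comp (measurable_fst.add measurable_snd)))

lemma lintegral_gaussianPDF_sub (y : ℝ) :
    ∫⁻ x, gaussianPDF 0 1 (y - x) ∂μ = ENNReal.ofReal (outputDensity μ y) := by
  rw [outputDensity, ofReal_integral_eq_lintegral_ofReal (integrable_gaussianPDFReal_sub μ y)
    (ae_of_all _ fun x ↦ (gaussianPDFReal_zero_one_pos _).le)]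
  rfl

lemma channelJoint_eq_withDensity :
    channelJoint μ = (μ.prod volume).withDensity (fun p ↦ gaussianPDF 0 1 (p.2 - p.1)) := by
  have hg : Measurable (fun p : ℝ × ℝ ↦ gaussianPDF 0 1 (p.2 - p.1)) :=
    (measurable_gaussianPDF 0 1).comp (measurable_snd.sub measurable_fst)
  have hT : MeasurePreserving (fun p : ℝ × ℝ ↦ (p.1, p.1 + p.2)) (μ.prod volume)
    (μ.prod volume) := measurePreserving_prod_add μ volume
  refine Measure.ext_of_lintegral _ fun f hf ↦ ?_
  rw [channelJoint, lintegral_map hf hT.measurable, gaussianReal_of_var_ne_zero 0 one_ne_zero,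
    prod_withDensity_right (measurable_gaussianPDF 0 1),
    lintegral_withDensity_eq_lintegral_mul _
      (show Measurable fun p : ℝ × ℝ ↦ gaussianPDF 0 1 p.2 by fun_prop)
      (show Measurable fun p : ℝ × ℝ ↦ f (p.1, p.1 + p.2) by fun_prop),
    lintegral_withDensity_eq_lintegral_mul _ hg hf, ← hT.lintegral_comp (hg.mul hf)]
  simp

lemma snd_channelJoint :
    (channelJoint μ).snd = volume.withDensity (fun y ↦ ENNReal.ofReal (outputDensity μ y)) := by
  have hg : Measurable (fun p : ℝ × ℝ ↦ gaussianPDF 0 1 (p.2 - p.1)) :=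
    (measurable_gaussianPDF 0 1).comp (measurable_snd.sub measurable_fst)
  refine Measure.ext_of_lintegral _ fun f hf ↦ ?_
  have hf' : Measurable (fun p : ℝ × ℝ ↦ f p.2) := hf.comp measurable_snd
  rw [Measure.snd, lintegral_map hf measurable_snd, channelJoint_eq_withDensity,
    lintegral_withDensity_eq_lintegral_mul _ hg hf',
    lintegral_prod_symm' _ (hg.mul hf'),
    lintegral_withDensity_eq_lintegral_mul _ (measurable_outputDensity μ).ennreal_ofReal hf]
  refine lintegral_congr fun y ↦ ?_
  simp only [Pi.mul_apply]
  rw [lintegral_mul_const _ (by fun_prop), lintegral_gaussianPDF_sub]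

lemma channelJoint_eq_withDensity_prod :
    channelJoint μ = ((channelJoint μ).fst.prod (channelJoint μ).snd).withDensity
      (fun p ↦ ENNReal.ofReal (gaussianPDFReal 0 1 (p.2 - p.1) / outputDensity μ p.2)) := by
  have hp := (measurable_outputDensity μ)
  have hq : Measurable (fun p : ℝ × ℝ ↦
      ENNReal.ofReal (gaussianPDFReal 0 1 (p.2 - p.1) / outputDensity μ p.2)) :=
    (((measurable_gaussianPDFReal 0 1).comp (measurable_snd.sub measurable_fst)).div
      (hp.comp measurable_snd)).ennreal_ofReal
  rw [fst_channelJoint, snd_channelJoint, prod_withDensity_right hp.ennreal_ofReal,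
    ← withDensity_mul _
      (show Measurable fun p : ℝ × ℝ ↦ ENNReal.ofReal (outputDensity μ p.2) by fun_prop) hq,
    channelJoint_eq_withDensity]
  congr 1
  ext p
  rw [Pi.mul_apply, ← ENNReal.ofReal_mul (outputDensity_pos μ p.2).le,
    mul_div_cancel₀ _ (outputDensity_pos μ p.2).ne', gaussianPDF]

lemma gaussianMI_eq_integral (h : Integrable (infoDensity μ) (μ.prod (gaussianReal 0 1))) :
    gaussianMI μ = ((∫ p, infoDensity μ p ∂(μ.prod (gaussianReal 0 1)) : ℝ) : EReal) := by
  set ν := (channelJoint μ).fst.prod (channelJoint μ).snd with hν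
  have hprob : IsProbabilityMeasure (channelJoint μ) :=
    Measure.isProbabilityMeasure_map (by fun_prop)
  have hp := (measurable_outputDensity μ)
  have hq : Measurable (fun p : ℝ × ℝ ↦
      gaussianPDFReal 0 1 (p.2 - p.1) / outputDensity μ p.2) :=
    ((measurable_gaussianPDFReal 0 1).comp (measurable_snd.sub measurable_fst)).div
      (hp.comp measurable_snd)
  have hlq : Measurable (fun p : ℝ × ℝ ↦
      log (gaussianPDFReal 0 1 (p.2 - p.1) / outputDensity μ p.2)) := measurable_log.comp hq
  have hac : channelJoint μ ≪ ν := by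
    conv_lhs => rw [channelJoint_eq_withDensity_prod]
    exact withDensity_absolutelyContinuous _ _
  have hrn : (fun p ↦ log ((channelJoint μ).rnDeriv ν p).toReal) =ᵐ[channelJoint μ]
      fun p ↦ log (gaussianPDFReal 0 1 (p.2 - p.1) / outputDensity μ p.2) := by
    have h1 := Measure.rnDeriv_withDensity ν hq.ennreal_ofReal
    rw [hν, ← channelJoint_eq_withDensity_prod, ← hν] at h1
    filter_upwards [hac.ae_le h1] with p hp
    rw [hp, ENNReal.toReal_ofReal
      (div_nonneg (gaussianPDFReal_zero_one_pos _).le (outputDensity_pos μ _).le)]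
  have hT : Measurable (fun p : ℝ × ℝ ↦ (p.1, p.1 + p.2)) := by fun_prop
  have hcomp : (fun p : ℝ × ℝ ↦ log (gaussianPDFReal 0 1 (p.2 - p.1) / outputDensity μ p.2)) ∘
      (fun p : ℝ × ℝ ↦ (p.1, p.1 + p.2)) = infoDensity μ := by
    ext p
    simp [infoDensity]
  have hint : Integrable (fun p ↦ log ((channelJoint μ).rnDeriv ν p).toReal)
      (channelJoint μ) := by
    rw [integrable_congr hrn, channelJoint, integrable_map_measure
      hlq.aestronglyMeasurable hT.aemeasurable, hcomp]
    exact h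
  change klDiv (channelJoint μ) ν = _
  rw [klDiv, if_pos ⟨hac, hint⟩, integral_congr_ae hrn, channelJoint,
    integral_map hT.aemeasurable hlq.aestronglyMeasurable, ← hcomp]
  rfl

end Output

lemma lintegral_div_outputDensity (μ : Measure ℝ) [IsProbabilityMeasure μ] {r : ℝ → ℝ}
    (hr : Measurable r) :
    ∫⁻ p, ENNReal.ofReal (r (p.1 + p.2) / outputDensity μ (p.1 + p.2))
      ∂(μ.prod (gaussianReal 0 1)) = ∫⁻ y, ENNReal.ofReal (r y) := by
  have hP := measurable_outputDensity μ
  have hf : Measurable (fun y ↦ ENNReal.ofReal (r y / outputDensity μ y)) := by fun_prop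
  have h1 : (channelJoint μ).snd = (μ.prod (gaussianReal 0 1)).map (fun p ↦ p.1 + p.2) := by
    rw [channelJoint, Measure.snd, Measure.map_map measurable_snd (by fun_prop)]
    rfl
  have hadd : Measurable (fun p : ℝ × ℝ ↦ p.1 + p.2) := by fun_prop
  rw [← lintegral_map hf hadd, ← h1, snd_channelJoint,
    lintegral_withDensity_eq_lintegral_mul _ hP.ennreal_ofReal hf]
  refine lintegral_congr fun y ↦ ?_
  rw [Pi.mul_apply, ← ENNReal.ofReal_mul (outputDensity_pos μ y).le,
    mul_div_cancel₀ _ (outputDensity_pos μ y).ne']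

/-- Mixture of the standard Gaussian and the Laplace densities, used as an output density in the
duality upper bound on the capacity. -/
noncomputable def refDensity (E y : ℝ) : ℝ :=
  (1 - E) * gaussianPDFReal 0 1 y + E * (exp (-|y|) / 2)

lemma measurable_refDensity (E : ℝ) : Measurable (refDensity E) := by
  have := measurable_gaussianPDFReal 0 1
  unfold refDensity
  fun_prop

lemma refDensity_pos {E : ℝ} (h0 : 0 < E) (h1 : E < 1) (y : ℝ) : 0 < refDensity E y :=
  add_pos (mul_pos (sub_pos.2 h1) (gaussianPDFReal_zero_one_pos y)) (by positivity)

lemma lintegral_refDensity {E : ℝ} (h0 : 0 < E) (h1 : E < 1) :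
    ∫⁻ y, ENNReal.ofReal (refDensity E y) = 1 := by
  have hexp : ∫ y : ℝ, exp (-|y|) = 2 := by
    rw [integral_comp_abs (f := fun y ↦ exp (-y)), integral_exp_neg_Ioi]
    simp
  have hint : Integrable (fun y : ℝ ↦ exp (-|y|)) :=
    Integrable.of_integral_ne_zero (by rw [hexp]; norm_num)
  have hg := (integrable_gaussianPDFReal 0 1).const_mul (1 - E)
  have hl := (hint.div_const 2).const_mul E
  have hr : Integrable (refDensity E) := hg.add hl
  rw [← ofReal_integral_eq_lintegral_ofReal hr
    (ae_of_all _ fun y ↦ (refDensity_pos h0 h1 y).le)]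
  simp only [refDensity]
  rw [integral_add hg hl, integral_const_mul, integral_const_mul, integral_div, hexp,
    integral_gaussianPDFReal_eq_one 0 one_ne_zero]
  simp

lemma integrable_div_outputDensity (μ : Measure ℝ) [IsProbabilityMeasure μ] {E : ℝ}
    (h0 : 0 < E) (h1 : E < 1) :
    Integrable (fun p : ℝ × ℝ ↦ refDensity E (p.1 + p.2) / outputDensity μ (p.1 + p.2))
      (μ.prod (gaussianReal 0 1)) := by
  have hP := measurable_outputDensity μ
  have hr := measurable_refDensity E
  refine ⟨Measurable.aestronglyMeasurable (by fun_prop), ?_⟩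
  rw [hasFiniteIntegral_iff_ofReal (ae_of_all _ fun p ↦
      (div_pos (refDensity_pos h0 h1 _) (outputDensity_pos μ _)).le),
    lintegral_div_outputDensity μ hr, lintegral_refDensity h0 h1]
  exact ENNReal.one_lt_top

lemma integral_div_outputDensity (μ : Measure ℝ) [IsProbabilityMeasure μ] {E : ℝ}
    (h0 : 0 < E) (h1 : E < 1) :
    ∫ p : ℝ × ℝ, refDensity E (p.1 + p.2) / outputDensity μ (p.1 + p.2)
      ∂(μ.prod (gaussianReal 0 1)) = 1 := by
  rw [integral_eq_lintegral_of_nonneg_ae (ae_of_all _ fun p ↦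
      (div_pos (refDensity_pos h0 h1 _) (outputDensity_pos μ _)).le)
      (integrable_div_outputDensity μ h0 h1).1,
    lintegral_div_outputDensity μ (measurable_refDensity E), lintegral_refDensity h0 h1]
  simp

lemma integrable_sq_gaussianReal : Integrable (fun z : ℝ ↦ z ^ 2) (gaussianReal 0 1) :=
  (memLp_id_gaussianReal (μ := 0) (v := 1) 2).integrable_sq

lemma integral_sq_gaussianReal : ∫ z, z ^ 2 ∂(gaussianReal 0 1) = 1 := by
  have h := variance_id_gaussianReal (μ := 0) (v := 1)
  rw [variance_of_integral_eq_zero aemeasurable_id (by simp)] at h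
  simpa using h

lemma integrable_abs_gaussianReal : Integrable (fun z : ℝ ↦ |z|) (gaussianReal 0 1) :=
  ((memLp_id_gaussianReal (μ := 0) (v := 1) 1).integrable (by simp)).abs

lemma integral_abs_gaussianReal_le : ∫ z, |z| ∂(gaussianReal 0 1) ≤ 1 := by
  have h : ∫ z, |z| ∂(gaussianReal 0 1) ≤ ∫ z, (1 / 2 + z ^ 2 / 2) ∂(gaussianReal 0 1) := by
    refine integral_mono integrable_abs_gaussianReal
      ((integrable_const _).add (integrable_sq_gaussianReal.div_const 2)) fun z ↦ ?_
    have := sq_nonneg (|z| - 1)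
    have := sq_abs z
    simp only
    linarith
  rw [integral_add (integrable_const _) (integrable_sq_gaussianReal.div_const 2),
    integral_div _ (fun z : ℝ ↦ z ^ 2), integral_sq_gaussianReal] at h
  norm_num at h
  exact h

lemma inv_sqrt_two_pi_le : (√(2 * π))⁻¹ ≤ 1 / 2 := by
  rw [one_div]
  refine inv_anti₀ two_pos (le_sqrt_of_sq_le ?_)
  linarith [pi_gt_three]

lemma gaussianPDFReal_div_add (x z : ℝ) :
    gaussianPDFReal 0 1 z / gaussianPDFReal 0 1 (x + z) = exp (x ^ 2 / 2 + x * z) := by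
  rw [gaussianPDFReal_zero_one, gaussianPDFReal_zero_one, mul_div_mul_left _ _ (by positivity),
    ← exp_sub]
  ring_nf

lemma log_gaussianPDFReal_div_refDensity_le {E a x : ℝ} (h0 : 0 < E) (hE : E ≤ 1 / 2)
    (ha : 1 ≤ a) (hEa : exp (-(a ^ 2 / 2)) = E) (hx : 0 ≤ x) (z : ℝ) :
    log (gaussianPDFReal 0 1 z / refDensity E (x + z)) ≤ (a / 2 + 1) * x + x * |z| + 2 * E := by
  have hφ := gaussianPDFReal_zero_one_pos z
  have hφ' := gaussianPDFReal_zero_one_pos (x + z)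
  have hr := refDensity_pos h0 (by linarith) (x + z)
  rw [log_le_iff_le_exp (by positivity), div_le_iff₀ hr]
  have hz := mul_le_mul_of_nonneg_left (le_abs_self z) hx
  rcases le_or_gt x a with hxa | hxa
  · have h1 : exp (-(2 * E)) ≤ 1 - E := by
      have h2 : (0 : ℝ) < 1 + 2 * E := by linarith
      rw [exp_neg]
      calc (exp (2 * E))⁻¹ ≤ (1 + 2 * E)⁻¹ := inv_anti₀ h2 (by linarith [add_one_le_exp (2 * E)])
        _ ≤ 1 - E := by
          rw [inv_le_iff_one_le_mul₀ h2]
          nlinarith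
    calc gaussianPDFReal 0 1 z
        = exp (x ^ 2 / 2 + x * z + 2 * E) * (exp (-(2 * E)) * gaussianPDFReal 0 1 (x + z)) := by
          rw [← mul_assoc, ← exp_add, add_neg_cancel_right, ← gaussianPDFReal_div_add,
            div_mul_cancel₀ _ hφ'.ne']
      _ ≤ exp ((a / 2 + 1) * x + x * |z| + 2 * E) *
          ((1 - E) * gaussianPDFReal 0 1 (x + z)) := by
          gcongr
          nlinarith
      _ ≤ _ := by
          gcongr
          exact le_add_of_nonneg_right (by positivity)
  · calc gaussianPDFReal 0 1 z ≤ 1 / 2 :=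
          (gaussianPDFReal_zero_one_le z).trans inv_sqrt_two_pi_le
      _ = exp (a ^ 2 / 2 + |x + z|) * (exp (-(a ^ 2 / 2)) * (exp (-|x + z|) / 2)) := by
          rw [exp_add, exp_neg, exp_neg]
          field_simp
      _ ≤ exp ((a / 2 + 1) * x + x * |z| + 2 * E) * (E * (exp (-|x + z|) / 2)) := by
          have h3 := abs_add_le x z
          rw [abs_of_nonneg hx] at h3
          rw [hEa]
          refine mul_le_mul_of_nonneg_right (exp_le_exp.2 ?_) (by positivity)
          nlinarith [mul_le_mul_of_nonneg_right (ha.trans hxa.le) (abs_nonneg z)]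
      _ ≤ _ := by
          gcongr
          exact le_add_of_nonneg_left (mul_nonneg (by linarith) hφ'.le)

lemma infoDensity_le (μ : Measure ℝ) [IsProbabilityMeasure μ] {E a : ℝ} (h0 : 0 < E)
    (hE : E ≤ 1 / 2) (ha : 1 ≤ a) (hEa : exp (-(a ^ 2 / 2)) = E) {p : ℝ × ℝ} (hp : 0 ≤ p.1) :
    infoDensity μ p ≤ (a / 2 + 1) * p.1 + p.1 * |p.2| + 2 * E +
      (refDensity E (p.1 + p.2) / outputDensity μ (p.1 + p.2) - 1) := by
  have hφ := gaussianPDFReal_zero_one_pos p.2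
  have hr := refDensity_pos h0 (by linarith : E < 1) (p.1 + p.2)
  have hP := outputDensity_pos μ (p.1 + p.2)
  have h1 := log_gaussianPDFReal_div_refDensity_le h0 hE ha hEa hp p.2
  have h2 := log_le_sub_one_of_pos (div_pos hr hP)
  rw [infoDensity, ← div_mul_div_cancel₀ hr.ne', log_mul (by positivity) (by positivity)]
  linarith

lemma neg_sq_le_infoDensity (μ : Measure ℝ) [IsProbabilityMeasure μ] (p : ℝ × ℝ) :
    -(p.2 ^ 2 / 2) ≤ infoDensity μ p := by
  have hφ := gaussianPDFReal_zero_one_pos p.2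
  have hP := outputDensity_pos μ (p.1 + p.2)
  rw [infoDensity, le_log_iff_exp_le (by positivity), le_div_iff₀ hP]
  calc _ ≤ exp (-(p.2 ^ 2 / 2)) * (√(2 * π))⁻¹ := by
        gcongr
        exact outputDensity_le μ _
    _ = _ := by rw [gaussianPDFReal_zero_one, mul_comm, neg_div]

lemma integrable_of_lintegral_ofReal_le {μ : Measure ℝ} {E : ℝ}
    (hμ : μ (Set.Iio 0) = 0) (hmean : ∫⁻ x, ENNReal.ofReal x ∂μ ≤ ENNReal.ofReal E) :
    Integrable (fun x : ℝ ↦ x) μ := by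
  have h : ∀ᵐ x ∂μ, 0 ≤ x := by simpa [ae_iff, Set.Iio] using hμ
  refine ⟨measurable_id.aestronglyMeasurable, ?_⟩
  rw [hasFiniteIntegral_iff_ofReal h]
  exact hmean.trans_lt ENNReal.ofReal_lt_top

lemma integral_le_of_lintegral_ofReal_le {μ : Measure ℝ} {E : ℝ} (h0 : 0 < E)
    (hμ : μ (Set.Iio 0) = 0)
    (hmean : ∫⁻ x, ENNReal.ofReal x ∂μ ≤ ENNReal.ofReal E) : ∫ x, x ∂μ ≤ E := by
  have h : ∀ᵐ x ∂μ, 0 ≤ x := by simpa [ae_iff, Set.Iio] using hμ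
  rw [integral_eq_lintegral_of_nonneg_ae h measurable_id.aestronglyMeasurable]
  exact ENNReal.toReal_le_of_le_ofReal h0.le hmean

section UpperBound

variable {μ : Measure ℝ} [IsProbabilityMeasure μ] {E a : ℝ}

lemma integrable_infoDensity_and_integral_le (h0 : 0 < E) (hE : E ≤ 1 / 2) (ha : 1 ≤ a)
    (hEa : exp (-(a ^ 2 / 2)) = E) (hμ : μ (Set.Iio 0) = 0)
    (hmean : ∫⁻ x, ENNReal.ofReal x ∂μ ≤ ENNReal.ofReal E) :
    Integrable (infoDensity μ) (μ.prod (gaussianReal 0 1)) ∧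
      ∫ p, infoDensity μ p ∂(μ.prod (gaussianReal 0 1)) ≤ E * (a / 2 + 4) := by
  have hE1 : E < 1 := by linarith
  have hid := integrable_of_lintegral_ofReal_le hμ hmean
  have hm := integral_le_of_lintegral_ofReal_le h0 hμ hmean
  have hnn : ∀ᵐ x ∂μ, 0 ≤ x := by simpa [ae_iff, Set.Iio] using hμ
  have hnn' : ∀ᵐ p ∂(μ.prod (gaussianReal 0 1)), 0 ≤ p.1 :=
    Measure.quasiMeasurePreserving_fst.ae hnn
  have i1 : Integrable (fun p : ℝ × ℝ ↦ (a / 2 + 1) * p.1) (μ.prod (gaussianReal 0 1)) :=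
    (hid.comp_fst _).const_mul _
  have i2 : Integrable (fun p : ℝ × ℝ ↦ p.1 * |p.2|) (μ.prod (gaussianReal 0 1)) :=
    hid.mul_prod integrable_abs_gaussianReal
  have i3 := integrable_div_outputDensity μ h0 hE1
  have i12 := i1.add i2
  have i123 := i12.add (integrable_const (2 * E))
  have i4 : Integrable (fun p : ℝ × ℝ ↦
      refDensity E (p.1 + p.2) / outputDensity μ (p.1 + p.2) - 1) (μ.prod (gaussianReal 0 1)) :=
    i3.sub (integrable_const 1)
  have hle : infoDensity μ ≤ᵐ[μ.prod (gaussianReal 0 1)] fun p ↦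
      (a / 2 + 1) * p.1 + p.1 * |p.2| + 2 * E +
      (refDensity E (p.1 + p.2) / outputDensity μ (p.1 + p.2) - 1) := by
    filter_upwards [hnn'] with p hp
    exact infoDensity_le μ h0 hE ha hEa hp
  have hint : Integrable (infoDensity μ) (μ.prod (gaussianReal 0 1)) :=
    integrable_of_le_of_le (measurable_infoDensity μ).aestronglyMeasurable
      (ae_of_all _ (neg_sq_le_infoDensity μ)) hle
      ((integrable_sq_gaussianReal.div_const 2).comp_snd μ).neg (i123.add i4)
  refine ⟨hint, (integral_mono_ae hint (i123.add i4) hle).trans ?_⟩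
  have e1 : ∫ p : ℝ × ℝ, p.1 ∂(μ.prod (gaussianReal 0 1)) = ∫ x, x ∂μ := by
    simpa using integral_fun_fst (μ := μ) (ν := gaussianReal 0 1) (fun x : ℝ ↦ x)
  have e2 := integral_prod_mul (μ := μ) (ν := gaussianReal 0 1) (fun x : ℝ ↦ x) (fun z ↦ |z|)
  have hz := integral_abs_gaussianReal_le
  have hx : 0 ≤ ∫ x, x ∂μ := integral_nonneg_of_ae hnn
  have hsplit : ∫ p : ℝ × ℝ, (a / 2 + 1) * p.1 + p.1 * |p.2| + 2 * E +
      (refDensity E (p.1 + p.2) / outputDensity μ (p.1 + p.2) - 1) ∂(μ.prod (gaussianReal 0 1))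
      = (a / 2 + 1) * (∫ x, x ∂μ) + (∫ x, x ∂μ) * (∫ z, |z| ∂(gaussianReal 0 1)) + 2 * E := by
    rw [integral_add (f := fun p : ℝ × ℝ ↦ (a / 2 + 1) * p.1 + p.1 * |p.2| + 2 * E) i123 i4,
      integral_add (f := fun p : ℝ × ℝ ↦ (a / 2 + 1) * p.1 + p.1 * |p.2|) i12
        (integrable_const _), integral_add i1 i2, integral_sub i3 (integrable_const _),
      integral_const_mul, integral_div_outputDensity μ h0 hE1, e1, e2]
    simp
  refine hsplit.le.trans ?_
  nlinarith

end UpperBound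

section LowerBound

variable {E a : ℝ}

/-- Two-point input law with mass `E / a` at `a` and the remaining mass at `0`. -/
noncomputable def twoPoint (E a : ℝ) : Measure ℝ :=
  ENNReal.ofReal (1 - E / a) • Measure.dirac 0 + ENNReal.ofReal (E / a) • Measure.dirac a

lemma div_mem_Ioo (h0 : 0 < E) (hE : E ≤ 1 / 2) (ha : 1 ≤ a) : E / a ∈ Set.Ioo 0 1 :=
  ⟨by positivity, by rw [div_lt_one (by linarith)]; linarith⟩

lemma isProbabilityMeasure_twoPoint (h0 : 0 < E) (hE : E ≤ 1 / 2) (ha : 1 ≤ a) :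
    IsProbabilityMeasure (twoPoint E a) := by
  obtain ⟨hq0, hq1⟩ := div_mem_Ioo h0 hE ha
  refine ⟨?_⟩
  simp only [twoPoint, Measure.add_apply, Measure.smul_apply, measure_univ, smul_eq_mul, mul_one]
  rw [← ENNReal.ofReal_add (by linarith) hq0.le]
  simp

lemma twoPoint_Iio (ha : 1 ≤ a) : twoPoint E a (Set.Iio 0) = 0 := by
  have : ¬ a < 0 := by linarith
  simp [twoPoint, this]

lemma lintegral_twoPoint (f : ℝ → ENNReal) :
    ∫⁻ x, f x ∂twoPoint E a = ENNReal.ofReal (1 - E / a) * f 0 + ENNReal.ofReal (E / a) * f a := by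
  simp [twoPoint, lintegral_add_measure, lintegral_smul_measure]

lemma integral_twoPoint (h0 : 0 < E) (hE : E ≤ 1 / 2) (ha : 1 ≤ a) (f : ℝ → ℝ) :
    ∫ x, f x ∂twoPoint E a = (1 - E / a) * f 0 + E / a * f a := by
  obtain ⟨hq0, hq1⟩ := div_mem_Ioo h0 hE ha
  have hi (c : ℝ) (b : ℝ) : Integrable f (ENNReal.ofReal c • Measure.dirac b) :=
    (integrable_dirac (by simp)).smul_measure ENNReal.ofReal_ne_top
  rw [twoPoint, integral_add_measure (hi _ _) (hi _ _), integral_smul_measure,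
    integral_smul_measure, integral_dirac, integral_dirac, ENNReal.toReal_ofReal hq0.le,
    ENNReal.toReal_ofReal (by linarith), smul_eq_mul, smul_eq_mul]

lemma ae_twoPoint {P : ℝ → Prop} (h0 : 0 < E) (hE : E ≤ 1 / 2) (ha : 1 ≤ a)
    (h : ∀ᵐ x ∂twoPoint E a, P x) : P 0 ∧ P a := by
  obtain ⟨hq0, hq1⟩ := div_mem_Ioo h0 hE ha
  rw [twoPoint, ae_add_measure_iff] at h
  have hc : ENNReal.ofReal (1 - E / a) ≠ 0 := by simpa using hq1
  have hc' : ENNReal.ofReal (E / a) ≠ 0 := by simpa using hq0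
  rw [Measure.ae_ennreal_smul_measure_iff hc, Measure.ae_ennreal_smul_measure_iff hc'] at h
  simpa [ae_dirac_eq] using h

lemma outputDensity_twoPoint (h0 : 0 < E) (hE : E ≤ 1 / 2) (ha : 1 ≤ a) (y : ℝ) :
    outputDensity (twoPoint E a) y =
      (1 - E / a) * gaussianPDFReal 0 1 y + E / a * gaussianPDFReal 0 1 (y - a) := by
  rw [outputDensity, integral_twoPoint h0 hE ha, sub_zero]

lemma le_infoDensity_twoPoint_zero (h0 : 0 < E) (hE : E ≤ 1 / 2) (ha : 1 ≤ a)
    (hEa : exp (-(a ^ 2 / 2)) = E) (z : ℝ) :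
    E / a - E / a * (E * exp (a * z)) ≤ infoDensity (twoPoint E a) (0, z) := by
  have := isProbabilityMeasure_twoPoint h0 hE ha
  have hφ := gaussianPDFReal_zero_one_pos z
  have hP := outputDensity_pos (twoPoint E a) z
  have h1 := log_le_sub_one_of_pos (div_pos hP hφ)
  have h2 : gaussianPDFReal 0 1 (z - a) = E * exp (a * z) * gaussianPDFReal 0 1 z := by
    have h := gaussianPDFReal_div_add (-a) z
    rw [div_eq_iff (gaussianPDFReal_zero_one_pos _).ne'] at h
    rw [h, ← hEa, ← exp_add, ← mul_assoc, ← exp_add, neg_add_eq_sub]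
    ring_nf
    simp
  have h3 : outputDensity (twoPoint E a) z / gaussianPDFReal 0 1 z =
      1 - E / a + E / a * (E * exp (a * z)) := by
    rw [outputDensity_twoPoint h0 hE ha, h2]
    field_simp
  rw [infoDensity, zero_add, ← inv_div (outputDensity _ _), log_inv]
  rw [h3] at h1 ⊢
  linarith

lemma le_infoDensity_twoPoint (h0 : 0 < E) (hE : E ≤ 1 / 2) (ha : 1 ≤ a)
    (hEa : exp (-(a ^ 2 / 2)) = E) (z : ℝ) :
    a ^ 2 / 2 - 1 - a * |z| ≤ infoDensity (twoPoint E a) (a, z) := by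
  have := isProbabilityMeasure_twoPoint h0 hE ha
  obtain ⟨hq0, hq1⟩ := div_mem_Ioo h0 hE ha
  have hφ := gaussianPDFReal_zero_one_pos z
  have hφ' := gaussianPDFReal_zero_one_pos (a + z)
  have hP := outputDensity_pos (twoPoint E a) (a + z)
  have h2 : gaussianPDFReal 0 1 (a + z) = E * exp (-(a * z)) * gaussianPDFReal 0 1 z := by
    have h := gaussianPDFReal_div_add a z
    rw [div_eq_iff hφ'.ne'] at h
    rw [h, ← hEa, ← exp_add, ← mul_assoc, ← exp_add]
    ring_nf
    simp
  have h3 : exp (-(a * z)) ≤ exp (a * |z|) := by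
    rw [exp_le_exp]
    nlinarith [neg_abs_le z]
  have h4 : 1 ≤ exp (a * |z|) := one_le_exp (by positivity)
  have h5 : E / a ≤ E := div_le_self h0.le ha
  have h6 : (2 : ℝ) ≤ exp 1 := by linarith [add_one_le_exp (1 : ℝ)]
  rw [infoDensity, le_log_iff_exp_le (by positivity), le_div_iff₀ hP,
    outputDensity_twoPoint h0 hE ha]
  simp only [add_sub_cancel_left]
  rw [h2]
  calc _ ≤ exp (a ^ 2 / 2 - 1 - a * |z|) * (1 * (E * exp (a * |z|) * gaussianPDFReal 0 1 z) +
          E * exp (a * |z|) * gaussianPDFReal 0 1 z) := by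
        gcongr
        · linarith
        · exact h5.trans (le_mul_of_one_le_right h0.le h4)
    _ = 2 / exp 1 * gaussianPDFReal 0 1 z := by
        rw [← hEa, exp_sub, exp_sub, exp_neg]
        field_simp
        ring
    _ ≤ _ := mul_le_of_le_one_left hφ.le ((div_le_one (exp_pos 1)).2 h6)

lemma le_gaussianMI_twoPoint (h0 : 0 < E) (hE : E ≤ 1 / 2) (ha : 1 ≤ a)
    (hEa : exp (-(a ^ 2 / 2)) = E) (hint : Integrable (infoDensity (twoPoint E a))
      ((twoPoint E a).prod (gaussianReal 0 1))) :
    ((E * (a / 2 - 2) : ℝ) : EReal) ≤ gaussianMI (twoPoint E a) := by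
  have := isProbabilityMeasure_twoPoint h0 hE ha
  obtain ⟨hq0, hq1⟩ := div_mem_Ioo h0 hE ha
  rw [gaussianMI_eq_integral _ hint, EReal.coe_le_coe_iff, integral_prod _ hint,
    integral_twoPoint h0 hE ha]
  obtain ⟨i0, ia⟩ := ae_twoPoint h0 hE ha hint.prod_right_ae
  have hexp : Integrable (fun z ↦ exp (a * z)) (gaussianReal 0 1) :=
    integrable_exp_mul_gaussianReal a
  have hmgf : ∫ z, exp (a * z) ∂(gaussianReal 0 1) = exp (a ^ 2 / 2) := by
    have h := congrFun (mgf_id_gaussianReal (μ := 0) (v := 1)) a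
    simpa [mgf] using h
  have j0 := (hexp.const_mul E).const_mul (E / a)
  have b0 := integral_mono ((integrable_const (E / a)).sub j0) i0
    (le_infoDensity_twoPoint_zero h0 hE ha hEa)
  have ja := integrable_abs_gaussianReal.const_mul a
  have ba := integral_mono ((integrable_const (a ^ 2 / 2 - 1)).sub ja) ia
    (le_infoDensity_twoPoint h0 hE ha hEa)
  simp only [Pi.sub_apply] at b0 ba
  rw [integral_sub (integrable_const _) j0, integral_const_mul, integral_const_mul, hmgf] at b0
  rw [integral_sub (integrable_const _) ja, integral_const_mul] at ba
  have hE' : E * exp (a ^ 2 / 2) = 1 := by rw [← hEa, ← exp_add]; simp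
  rw [hE'] at b0
  simp only [integral_const, probReal_univ, smul_eq_mul, one_mul, mul_one, sub_self] at b0 ba
  have hz := integral_abs_gaussianReal_le
  have hba : a ^ 2 / 2 - 1 - a ≤ ∫ z, infoDensity (twoPoint E a) (a, z) ∂gaussianReal 0 1 := by
    nlinarith
  have h1 := mul_nonneg (sub_pos.2 hq1).le b0
  have h2 := mul_le_mul_of_nonneg_left hba hq0.le
  have h3 : E / a * (a ^ 2 / 2 - 1 - a) = E * (a / 2 - 1) - E / a := by
    field_simp
    ring
  have h4 : E / a ≤ E := div_le_self h0.le ha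
  linarith

end LowerBound

section Capacity

variable {E a : ℝ}

lemma C_G_le (h0 : 0 < E) (hE : E ≤ 1 / 2) (ha : 1 ≤ a) (hEa : exp (-(a ^ 2 / 2)) = E) :
    C_G E ≤ ((E * (a / 2 + 4) : ℝ) : EReal) := by
  refine iSup_le fun μ ↦ iSup_le fun _ ↦ iSup_le fun hμ ↦ iSup_le fun hmean ↦ ?_
  obtain ⟨hint, hle⟩ := integrable_infoDensity_and_integral_le h0 hE ha hEa hμ hmean
  rw [gaussianMI_eq_integral μ hint]
  exact_mod_cast hle

lemma le_C_G (h0 : 0 < E) (hE : E ≤ 1 / 2) (ha : 1 ≤ a) (hEa : exp (-(a ^ 2 / 2)) = E) :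
    ((E * (a / 2 - 2) : ℝ) : EReal) ≤ C_G E := by
  have hprob := isProbabilityMeasure_twoPoint h0 hE ha
  have hμ := twoPoint_Iio (E := E) ha
  have hmean : ∫⁻ x, ENNReal.ofReal x ∂twoPoint E a ≤ ENNReal.ofReal E := by
    have ha0 : a ≠ 0 := by linarith
    rw [lintegral_twoPoint, ← ENNReal.ofReal_mul (div_mem_Ioo h0 hE ha).1.le,
      div_mul_cancel₀ _ ha0]
    simp
  have hint := (integrable_infoDensity_and_integral_le h0 hE ha hEa hμ hmean).1
  exact (le_gaussianMI_twoPoint h0 hE ha hEa hint).trans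
    (le_iSup_of_le _ (le_iSup_of_le hprob (le_iSup_of_le hμ (le_iSup_of_le hmean le_rfl))))

lemma C_G_toReal_mem_Icc (h0 : 0 < E) (hE : E ≤ 1 / 2) (ha : 1 ≤ a)
    (hEa : exp (-(a ^ 2 / 2)) = E) :
    (C_G E).toReal ∈ Set.Icc (E * (a / 2 - 2)) (E * (a / 2 + 4)) := by
  have hl := le_C_G h0 hE ha hEa
  have hu := C_G_le h0 hE ha hEa
  exact ⟨EReal.toReal_le_toReal hl (EReal.coe_ne_bot _) (hu.trans_lt (EReal.coe_lt_top _)).ne,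
    EReal.toReal_le_toReal hu ((EReal.bot_lt_coe _).trans_le hl).ne' (EReal.coe_ne_top _)⟩

end Capacity

lemma tendsto_sqrt_log_one_div :
    Tendsto (fun E : ℝ ↦ √(log (1 / E))) (nhdsWithin 0 (Set.Ioi 0)) atTop := by
  simp only [one_div]
  exact tendsto_sqrt_atTop.comp (tendsto_log_atTop.comp tendsto_inv_nhdsGT_zero)

lemma C_G_div_mem_Icc {E : ℝ} (h0 : 0 < E) (hE : E ≤ 1 / 2) (hs : 1 ≤ √(log (1 / E))) :
    (C_G E).toReal / (E * √(log (1 / E))) ∈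
      Set.Icc (1 / √2 - 2 / √(log (1 / E))) (1 / √2 + 4 / √(log (1 / E))) := by
  set s := √(log (1 / E)) with hsdef
  have hlog : s ^ 2 = log (1 / E) :=
    sq_sqrt (sqrt_ne_zero'.1 (by linarith)).le
  have h2 : √2 ^ 2 = 2 := sq_sqrt (by norm_num)
  have h2' : 1 ≤ √2 := one_le_sqrt.2 (by norm_num)
  have hEa : exp (-((√2 * s) ^ 2 / 2)) = E := by
    rw [mul_pow, h2, hlog, mul_div_cancel_left₀ _ two_ne_zero, one_div, log_inv, neg_neg,
      exp_log h0]
  obtain ⟨hl, hu⟩ := C_G_toReal_mem_Icc h0 hE (one_le_mul_of_one_le_of_one_le h2' hs) hEa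
  have hinv : 1 / √2 = √2 / 2 := by
    field_simp
    exact h2.symm
  have hs0 : 0 < s := by linarith
  rw [hinv]
  constructor
  · rw [le_div_iff₀ (by positivity)]
    convert hl using 1
    field_simp
  · rw [div_le_iff₀ (by positivity)]
    convert hu using 1
    field_simp

end LowIntensity

theorem gaussian_low_snr_asymptotic_capacity :
    Tendsto (fun E : ℝ => (C_G E).toReal / (E * Real.sqrt (Real.log (1 / E))))
      (nhdsWithin 0 (Set.Ioi 0)) (nhds (1 / Real.sqrt 2)) := by
  have hs := tendsto_sqrt_log_one_div
  have hl := (tendsto_const_nhds (x := (2 : ℝ))).div_atTop hs |>.const_sub (1 / Real.sqrt 2)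
  have hu := (tendsto_const_nhds (x := (4 : ℝ))).div_atTop hs |>.const_add (1 / Real.sqrt 2)
  rw [sub_zero] at hl
  rw [add_zero] at hu
  have hev : ∀ᶠ E : ℝ in nhdsWithin 0 (Set.Ioi 0), (C_G E).toReal / (E * √(Real.log (1 / E))) ∈
      Set.Icc (1 / √2 - 2 / √(Real.log (1 / E))) (1 / √2 + 4 / √(Real.log (1 / E))) := by
    filter_upwards [hs.eventually_ge_atTop 1, Ioc_mem_nhdsGT (one_half_pos (α := ℝ))] with E h1 hE
    exact C_G_div_mem_Icc hE.1 hE.2 h1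
  exact tendsto_of_tendsto_of_tendsto_of_le_of_le' hl hu (hev.mono fun _ h ↦ h.1)
    (hev.mono fun _ h ↦ h.2)
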